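/- arXiv:2002.03722 — 7 statements merged into one kernel-verified Lean document; each statement's English description precedes it below -/
import Mathlib

section
/- Assume the maps z ↦ ∇_xz𝓛(z, x) and z ↦ ∇_zz𝓛(z, x) are L_xz- and L_zz-Lipschitz in operator norm, and that ‖J_t‖ ≤ L_J. Then, with L = L_xz + L_J L_zz, the automatic estimator satisfies |g²_t − g*| ≤ ‖R(J_t)‖ · |z_t − z*| + (L/2) · |z_t − z*|². -/
noncomputable section

/-- `Euc k` is the Euclidean space `ℝ^k`. -/
abbrev Euc (k : ℕ) : Type := EuclideanSpace ℝ (Fin k)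

/-- `∇ₓ𝓛(z, x)`: the gradient of `𝓛` with respect to its second (`x`) argument. -/
noncomputable def gradx {m n : ℕ} (L : Euc m → Euc n → ℝ) (x : Euc n) (z : Euc m) : Euc n :=
  gradient (fun x' => L z x') x

/-- `∇_z𝓛(z, x)`: the gradient of `𝓛` with respect to its first (`z`) argument. -/
noncomputable def gradz {m n : ℕ} (L : Euc m → Euc n → ℝ) (x : Euc n) (z : Euc m) : Euc m :=
  gradient (fun w => L w x) z

/-- `∇_zz𝓛(z, x) ∈ ℝ^{m×m}` as a continuous linear map. -/
noncomputable def Hzz {m n : ℕ} (L : Euc m → Euc n → ℝ) (x : Euc n) (z : Euc m) :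
    Euc m →L[ℝ] Euc m :=
  fderiv ℝ (gradz L x) z

/-- `∇ₓz𝓛(z, x) ∈ ℝ^{n×m}`, acting on `m`-vectors and producing `n`-vectors. -/
noncomputable def Hxz {m n : ℕ} (L : Euc m → Euc n → ℝ) (x : Euc n) (z : Euc m) :
    Euc m →L[ℝ] Euc n :=
  fderiv ℝ (gradx L x) z

/-- `R(J) = J∇_zz𝓛(z*, x) + ∇ₓz𝓛(z*, x)`. -/
noncomputable def Rmap {m n : ℕ} (L : Euc m → Euc n → ℝ) (x : Euc n) (zstar : Euc m)
    (J : Euc m →L[ℝ] Euc n) : Euc m →L[ℝ] Euc n :=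
  J.comp (Hzz L x zstar) + Hxz L x zstar

/-- First-order Taylor estimate: if `f'` satisfies a Lipschitz bound centred at `a`, then `f` differs
from its linearization at `a` by at most `C / 2 * ‖b - a‖ ^ 2`. -/
theorem norm_sub_sub_fderiv_le_of_lipschitz {E F : Type*} [NormedAddCommGroup E] [NormedSpace ℝ E]
    [NormedAddCommGroup F] [NormedSpace ℝ F] {f : E → F} {f' : E → E →L[ℝ] F} {a : E} {C : ℝ}
    (hf : ∀ z, HasFDerivAt f (f' z) z) (hLip : ∀ z, ‖f' z - f' a‖ ≤ C * ‖z - a‖) (b : E) :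
    ‖f b - f a - f' a (b - a)‖ ≤ C / 2 * ‖b - a‖ ^ 2 := by
  have hline (t : ℝ) : HasDerivAt (fun t : ℝ => a + t • (b - a)) (b - a) t := by
    simpa using ((hasDerivAt_id t).smul_const (b - a)).const_add a
  have hderiv (t : ℝ) : HasDerivAt (fun t : ℝ => f (a + t • (b - a)) - f a - t • f' a (b - a))
      (f' (a + t • (b - a)) (b - a) - f' a (b - a)) t := by
    refine ((((hf _).comp_hasDerivAt t (hline t)).sub_const (f a)).sub
      ((hasDerivAt_id t).smul_const (f' a (b - a)))).congr_deriv ?_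
    rw [one_smul]
  have hbound (t : ℝ) : HasDerivAt (fun t : ℝ => C / 2 * ‖b - a‖ ^ 2 * t ^ 2)
      (C * ‖b - a‖ ^ 2 * t) t := by
    refine ((hasDerivAt_pow 2 t).const_mul (C / 2 * ‖b - a‖ ^ 2)).congr_deriv ?_
    push_cast
    ring
  have key := image_norm_le_of_norm_deriv_right_le_deriv_boundary (a := (0 : ℝ)) (b := 1)
    (fun t _ => (hderiv t).continuousAt.continuousWithinAt)
    (fun t _ => (hderiv t).hasDerivWithinAt) (by simp) hbound
    (fun t ht => by
      calc ‖f' (a + t • (b - a)) (b - a) - f' a (b - a)‖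
          ≤ ‖f' (a + t • (b - a)) - f' a‖ * ‖b - a‖ :=
            (f' (a + t • (b - a)) - f' a).le_opNorm (b - a)
        _ ≤ C * ‖a + t • (b - a) - a‖ * ‖b - a‖ := by gcongr; exact hLip _
        _ = C * ‖b - a‖ ^ 2 * t := by
            rw [add_sub_cancel_left, norm_smul, Real.norm_of_nonneg ht.1]
            ring)
    (Set.right_mem_Icc.2 zero_le_one)
  simpa using key

/-- The partial gradient `gradx` of a `C²` function is differentiable in `z`. -/
theorem differentiable_gradx {m n : ℕ} {L : Euc m → Euc n → ℝ}
    (hC : ContDiff ℝ 2 fun p : Euc m × Euc n => L p.1 p.2) (x : Euc n) :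
    Differentiable ℝ (gradx L x) := by
  have h : ContDiff ℝ 1 fun z => fderiv ℝ (L z) x :=
    ContDiff.fderiv (m := 2) hC contDiff_const (by norm_num)
  exact (InnerProductSpace.toDual ℝ (Euc n)).symm.toContinuousLinearEquiv.differentiable.comp
    (h.differentiable one_ne_zero)

/-- The partial gradient `gradz` of a `C²` function is differentiable in `z`. -/
theorem differentiable_gradz {m n : ℕ} {L : Euc m → Euc n → ℝ}
    (hC : ContDiff ℝ 2 fun p : Euc m × Euc n => L p.1 p.2) (x : Euc n) :
    Differentiable ℝ (gradz L x) := by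
  have hx : ContDiff ℝ 2 fun w => L w x := hC.comp (contDiff_id.prodMk contDiff_const)
  have h : ContDiff ℝ 1 (fderiv ℝ fun w => L w x) := hx.fderiv_right (by norm_num)
  exact (InnerProductSpace.toDual ℝ (Euc m)).symm.toContinuousLinearEquiv.differentiable.comp
    (h.differentiable one_ne_zero)

/-- convergence of the automatic estimator `g²_t = ∇ₓ𝓛(z_t,x) + J_t∇_z𝓛(z_t,x)`:
`|g²_t − g*| ≤ ‖R(J_t)‖·|z_t − z*| + (L/2)·|z_t − z*|²` with `L = L_xz + L_J·L_zz`. -/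
theorem automatic_estimator_bound {m n : ℕ} (L : Euc m → Euc n → ℝ) (x : Euc n)
    (hC : ContDiff ℝ 2 fun p : Euc m × Euc n => L p.1 p.2)
    (zstar : Euc m) (hmin : ∀ z, L zstar x ≤ L z x) (hcrit : gradz L x zstar = 0)
    (zt : Euc m) (Jt : Euc m →L[ℝ] Euc n)
    (Lxz Lzz LJ : ℝ) (hLxz : 0 ≤ Lxz) (hLzz : 0 ≤ Lzz)
    (hLipxz : ∀ z₁ z₂ : Euc m, ‖Hxz L x z₁ - Hxz L x z₂‖ ≤ Lxz * ‖z₁ - z₂‖)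
    (hLipzz : ∀ z₁ z₂ : Euc m, ‖Hzz L x z₁ - Hzz L x z₂‖ ≤ Lzz * ‖z₁ - z₂‖)
    (hJ : ‖Jt‖ ≤ LJ) :
    ‖(gradx L x zt + Jt (gradz L x zt)) - gradx L x zstar‖
      ≤ ‖Rmap L x zstar Jt‖ * ‖zt - zstar‖ + (Lxz + LJ * Lzz) / 2 * ‖zt - zstar‖ ^ 2 := by
  have hderiv (z : Euc m) : HasFDerivAt (fun z => gradx L x z + Jt (gradz L x z))
      (Rmap L x z Jt) z := by
    rw [Rmap, add_comm]
    exact (differentiable_gradx hC x z).hasFDerivAt.add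
      (Jt.hasFDerivAt.comp z (differentiable_gradz hC x z).hasFDerivAt)
  have hLip (z : Euc m) :
      ‖Rmap L x z Jt - Rmap L x zstar Jt‖ ≤ (Lxz + LJ * Lzz) * ‖z - zstar‖ := by
    calc ‖Rmap L x z Jt - Rmap L x zstar Jt‖
        = ‖(Hxz L x z - Hxz L x zstar) + Jt.comp (Hzz L x z - Hzz L x zstar)‖ := by
          rw [Rmap, Rmap, ContinuousLinearMap.comp_sub]
          congr 1
          abel
      _ ≤ ‖Hxz L x z - Hxz L x zstar‖ + ‖Jt‖ * ‖Hzz L x z - Hzz L x zstar‖ :=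
          (norm_add_le _ _).trans (by gcongr; exact Jt.opNorm_comp_le _)
      _ ≤ Lxz * ‖z - zstar‖ + LJ * (Lzz * ‖z - zstar‖) := by
          have := (norm_nonneg Jt).trans hJ
          gcongr
          · exact hLipxz z zstar
          · exact hLipzz z zstar
      _ = (Lxz + LJ * Lzz) * ‖z - zstar‖ := by ring
  have key := norm_sub_sub_fderiv_le_of_lipschitz hderiv hLip zt
  simp only [hcrit, map_zero, add_zero] at key
  calc ‖(gradx L x zt + Jt (gradz L x zt)) - gradx L x zstar‖
      ≤ ‖Rmap L x zstar Jt (zt - zstar)‖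
          + ‖gradx L x zt + Jt (gradz L x zt) - gradx L x zstar
              - Rmap L x zstar Jt (zt - zstar)‖ := norm_le_norm_add_norm_sub' _ _
    _ ≤ _ := add_le_add ((Rmap L x zstar Jt).le_opNorm _) key
end
end

section
/- Assume ∇_zz𝓛(z, x) is invertible on the relevant domain, the map z ↦ 𝒥(z, x) is L_𝒥-Lipschitz in operator norm, ‖𝒥(z_t, x)‖ ≤ L_J, the map z ↦ ∇_z𝓛(z, x) is L_z-Lipschitz, and z ↦ ∇_xz𝓛(z, x), z ↦ ∇_zz𝓛(z, x) are L_xz- and L_zz-Lipschitz in operator norm. Then, with L = L_xz + L_J L_zz, the implicit estimator satisfies |g³_t − g*| ≤ (L/2 + L_𝒥 L_z) · |z_t − z*|². -/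
noncomputable section

/-- `𝒥(z, x) = −∇ₓz𝓛(z, x)·[∇_zz𝓛(z, x)]⁻¹` (using `Ring.inverse` for the inverse of the
Hessian, which is the genuine inverse when the Hessian is invertible). -/
noncomputable def Jcal {m n : ℕ} (L : Euc m → Euc n → ℝ) (x : Euc n) (z : Euc m) :
    Euc m →L[ℝ] Euc n :=
  -(Hxz L x z).comp (Ring.inverse (Hzz L x z))

/-- If the derivative of `f` vanishes at `a` with at most linear growth `K ‖z - a‖`, then
`f` deviates from `f a` by at most `K / 2 * ‖b - a‖ ^ 2`. -/
theorem norm_sub_le_of_norm_fderiv_le_mul_norm_sub {E F : Type*}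
    [NormedAddCommGroup E] [NormedSpace ℝ E] [NormedAddCommGroup F] [NormedSpace ℝ F]
    {f : E → F} {f' : E → E →L[ℝ] F} {a : E} {K : ℝ} (hf : ∀ z, HasFDerivAt f (f' z) z)
    (hK : ∀ z, ‖f' z‖ ≤ K * ‖z - a‖) (b : E) :
    ‖f b - f a‖ ≤ K / 2 * ‖b - a‖ ^ 2 := by
  have hline (t : ℝ) : HasDerivAt (fun t : ℝ => a + t • (b - a)) (b - a) t := by
    simpa using ((hasDerivAt_id t).smul_const (b - a)).const_add a
  have hg (t : ℝ) : HasDerivAt (fun t : ℝ => f (a + t • (b - a)) - f a)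
      (f' (a + t • (b - a)) (b - a)) t :=
    ((hf _).comp_hasDerivAt t (hline t)).sub_const _
  have hB (t : ℝ) : HasDerivAt (fun t : ℝ => K / 2 * ‖b - a‖ ^ 2 * t ^ 2)
      (K * ‖b - a‖ ^ 2 * t) t :=
    ((hasDerivAt_pow 2 t).const_mul (K / 2 * ‖b - a‖ ^ 2)).congr_deriv (by
      norm_num
      ring)
  have key := image_norm_le_of_norm_deriv_right_le_deriv_boundary (a := 0) (b := 1)
    (fun t _ => (hg t).continuousAt.continuousWithinAt)
    (fun t _ => (hg t).hasDerivWithinAt) (by simp) hB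
    (fun t ht => by
      calc ‖f' (a + t • (b - a)) (b - a)‖
          ≤ ‖f' (a + t • (b - a))‖ * ‖b - a‖ := ContinuousLinearMap.le_opNorm _ _
        _ ≤ K * ‖a + t • (b - a) - a‖ * ‖b - a‖ := by gcongr; exact hK _
        _ = K * ‖b - a‖ ^ 2 * t := by
          rw [add_sub_cancel_left, norm_smul, Real.norm_of_nonneg ht.1]
          ring)
    (Set.right_mem_Icc.2 zero_le_one)
  simpa using key

/-- convergence of the implicit estimator
`g³_t = ∇ₓ𝓛(z_t,x) + 𝒥(z_t,x)∇_z𝓛(z_t,x)`: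
`|g³_t − g*| ≤ (L/2 + L_𝒥·L_z)·|z_t − z*|²` with `L = L_xz + L_J·L_zz`. -/
theorem implicit_estimator_bound {m n : ℕ} (L : Euc m → Euc n → ℝ) (x : Euc n)
    (hC : ContDiff ℝ 2 fun p : Euc m × Euc n => L p.1 p.2)
    (zstar : Euc m) (hmin : ∀ z, L zstar x ≤ L z x) (hcrit : gradz L x zstar = 0)
    (hinv : ∀ z : Euc m, IsUnit (Hzz L x z))
    (zt : Euc m)
    (Lz Lxz Lzz LJ LJc : ℝ) (hLxz : 0 ≤ Lxz) (hLzz : 0 ≤ Lzz) (hLz : 0 ≤ Lz) (hLJc : 0 ≤ LJc)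
    (hLipz : ∀ z₁ z₂ : Euc m, ‖gradz L x z₁ - gradz L x z₂‖ ≤ Lz * ‖z₁ - z₂‖)
    (hLipxz : ∀ z₁ z₂ : Euc m, ‖Hxz L x z₁ - Hxz L x z₂‖ ≤ Lxz * ‖z₁ - z₂‖)
    (hLipzz : ∀ z₁ z₂ : Euc m, ‖Hzz L x z₁ - Hzz L x z₂‖ ≤ Lzz * ‖z₁ - z₂‖)
    (hLipJ : ∀ z₁ z₂ : Euc m, ‖Jcal L x z₁ - Jcal L x z₂‖ ≤ LJc * ‖z₁ - z₂‖)
    (hJb : ‖Jcal L x zt‖ ≤ LJ) :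
    ‖(gradx L x zt + Jcal L x zt (gradz L x zt)) - gradx L x zstar‖
      ≤ ((Lxz + LJ * Lzz) / 2 + LJc * Lz) * ‖zt - zstar‖ ^ 2 := by
  have hF (z : Euc m) : HasFDerivAt (fun z => gradx L x z + Jcal L x zt (gradz L x z))
      (Hxz L x z + (Jcal L x zt).comp (Hzz L x z)) z :=
    (differentiable_gradx hC x z).hasFDerivAt.add
      ((Jcal L x zt).hasFDerivAt.comp z (differentiable_gradz hC x z).hasFDerivAt)
  have hzero : Hxz L x zt + (Jcal L x zt).comp (Hzz L x zt) = 0 := by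
    have hi : (Ring.inverse (Hzz L x zt)).comp (Hzz L x zt) = ContinuousLinearMap.id ℝ _ :=
      Ring.inverse_mul_cancel _ (hinv zt)
    rw [Jcal, ContinuousLinearMap.neg_comp, ContinuousLinearMap.comp_assoc, hi,
      ContinuousLinearMap.comp_id, add_neg_cancel]
  have hbound (z : Euc m) : ‖Hxz L x z + (Jcal L x zt).comp (Hzz L x z)‖
      ≤ (Lxz + LJ * Lzz) * ‖z - zt‖ := by
    have hLJ : 0 ≤ LJ := (norm_nonneg _).trans hJb
    calc ‖Hxz L x z + (Jcal L x zt).comp (Hzz L x z)‖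
        = ‖(Hxz L x z - Hxz L x zt) + (Jcal L x zt).comp (Hzz L x z - Hzz L x zt)‖ := by
          rw [ContinuousLinearMap.comp_sub, sub_add_sub_comm, hzero, sub_zero]
      _ ≤ ‖Hxz L x z - Hxz L x zt‖ + ‖Jcal L x zt‖ * ‖Hzz L x z - Hzz L x zt‖ :=
          (norm_add_le _ _).trans
            (add_le_add_right (ContinuousLinearMap.opNorm_comp_le _ _) _)
      _ ≤ Lxz * ‖z - zt‖ + LJ * (Lzz * ‖z - zt‖) := by
          gcongr
          exacts [hLipxz z zt, hLipzz z zt]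
      _ = (Lxz + LJ * Lzz) * ‖z - zt‖ := by ring
  have key := norm_sub_le_of_norm_fderiv_le_mul_norm_sub hF hbound zstar
  rw [hcrit, map_zero, add_zero, norm_sub_rev, norm_sub_rev zstar] at key
  refine key.trans ?_
  gcongr
  exact le_add_of_nonneg_right (mul_nonneg hLJc hLz)
end
end

section
/- Let α ∈ (0, 1) and a, b > 0, and let (δ_t)_{t≥1} be a sequence of nonnegative reals satisfying δ_{t+1} ≤ (1 − a t^{−α}) δ_t + b t^{−2α} for all t ≥ 1. Then δ_t ≤ 4 (b/a) t^{−α} + o(t^{−α}); in particular limsup_{t→∞} t^α δ_t ≤ 4 b/a. -/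
/-- One step of the recursion for the rescaled quantity `x = t ^ α * δ t`. -/
lemma rescaled_step_le {α a b t d e : ℝ} (hα : 0 < α) (hα1 : α < 1) (ha : 0 < a) (hb : 0 < b)
    (ht : 0 < t) (he : 0 ≤ e)
    (hrec : e ≤ (1 - a * t ^ (-α)) * d + b * t ^ (-(2 * α)))
    (hsmall : a * t ^ (-α) ≤ 1) (hinv : t⁻¹ ≤ a / 4 * t ^ (-α)) :
    (t + 1) ^ α * e ≤ max (t ^ α * d) (4 * (b / a)) - 2 * b * t ^ (-α) := by
  set p := t ^ (-α) with hp
  set q := t ^ α with hq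
  set M := max (q * d) (4 * (b / a)) with hM
  have hp0 : 0 < p := Real.rpow_pos_of_pos ht _
  have hq0 : 0 < q := Real.rpow_pos_of_pos ht _
  have hqp : q * p = 1 := by
    rw [hp, hq, ← Real.rpow_add ht, add_neg_cancel, Real.rpow_zero]
  have hpp : t ^ (-(2 * α)) = p * p := by
    rw [hp, ← Real.rpow_add ht]; congr 1; ring
  have hxM : q * d ≤ M := le_max_left _ _
  have hCM : 4 * b ≤ a * M := by
    calc 4 * b = a * (4 * (b / a)) := by field_simp
      _ ≤ a * M := mul_le_mul_of_nonneg_left (le_max_right _ _) ha.le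
  have hgrow : (t + 1) ^ α ≤ (1 + t⁻¹) * q := by
    have h1 : t + 1 = (1 + t⁻¹) * t := by field_simp
    have ht' : 0 < t⁻¹ := inv_pos.2 ht
    rw [h1, Real.mul_rpow (by positivity) ht.le]
    refine mul_le_mul_of_nonneg_right ?_ hq0.le
    calc (1 + t⁻¹) ^ α ≤ (1 + t⁻¹) ^ (1 : ℝ) :=
          Real.rpow_le_rpow_of_exponent_le (by linarith) hα1.le
      _ = 1 + t⁻¹ := Real.rpow_one _
  have hqe : q * e ≤ (1 - a * p) * M + b * p := by
    calc q * e ≤ q * ((1 - a * p) * d + b * (p * p)) := by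
          rw [hpp] at hrec; exact mul_le_mul_of_nonneg_left hrec hq0.le
      _ = (1 - a * p) * (q * d) + b * p * (q * p) := by ring
      _ ≤ (1 - a * p) * M + b * p := by
          rw [hqp, mul_one]
          gcongr
  have hdrop : q * e ≤ M - 3 / 4 * (a * M) * p := by nlinarith
  have hM0 : 0 < M := by
    by_contra h
    nlinarith
  have ht' : 0 < t⁻¹ := inv_pos.2 ht
  calc (t + 1) ^ α * e ≤ (1 + t⁻¹) * q * e := mul_le_mul_of_nonneg_right hgrow he
    _ = (1 + t⁻¹) * (q * e) := by ring
    _ ≤ (1 + t⁻¹) * (M - 3 / 4 * (a * M) * p) := mul_le_mul_of_nonneg_left hdrop (by positivity)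
    _ ≤ M - 3 / 4 * (a * M) * p + t⁻¹ * M := by
        have : 0 ≤ t⁻¹ * (3 / 4 * (a * M) * p) := by positivity
        linarith
    _ ≤ M - 3 / 4 * (a * M) * p + a / 4 * p * M := by gcongr
    _ ≤ M - 2 * b * p := by nlinarith

/-- A nonnegative sequence that decreases by the terms of a non-summable series while above a
level `C`, and does not leave `(-∞, C]`, is eventually at most `C`. -/
lemma eventually_le_of_le_max_sub {x p : ℕ → ℝ} {C : ℝ} {T : ℕ} (hx : ∀ t, 0 ≤ x t)
    (hp : ∀ t, 0 ≤ p t) (hsum : ¬ Summable p)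
    (hstep : ∀ t, T ≤ t → x (t + 1) ≤ max (x t) C - p t) :
    ∀ᶠ t in Filter.atTop, x t ≤ C := by
  by_cases h : ∃ s, T ≤ s ∧ x s ≤ C
  · obtain ⟨s, hs, hsC⟩ := h
    filter_upwards [Filter.eventually_ge_atTop s] with t ht
    induction t, ht using Nat.le_induction with
    | base => exact hsC
    | succ n hn ih =>
      have h1 := hstep n (hs.trans hn)
      rw [max_eq_right ih] at h1
      linarith [hp n]
  · push Not at h
    refine absurd ((summable_nat_add_iff T).1 ?_) hsum
    have hbound : ∀ n, ∑ i ∈ Finset.range n, p (i + T) ≤ x T - x (n + T) := by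
      intro n
      induction n with
      | zero => simp
      | succ n ih =>
        have h1 := hstep (n + T) (Nat.le_add_left _ _)
        rw [max_eq_left (h _ (Nat.le_add_left _ _)).le] at h1
        rw [Finset.sum_range_succ, Nat.add_right_comm n 1 T]
        linarith
    exact summable_of_sum_range_le (c := x T) (fun n => hp _)
      fun n => (hbound n).trans (by linarith [hx (n + T)])

/-- a recursion lemma with polynomially decaying contraction and perturbation.
If `δ_t ≥ 0` satisfies `δ_{t+1} ≤ (1 − a t^{−α})δ_t + b t^{−2α}` for all `t ≥ 1`, with
`α ∈ (0,1)` and `a, b > 0`, then `δ_t ≤ 4(b/a)t^{−α} + o(t^{−α})`; in particular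
`limsup_t t^α δ_t ≤ 4b/a`. -/
theorem polynomial_recursion_bound (α a b : ℝ) (hα : 0 < α) (hα1 : α < 1)
    (ha : 0 < a) (hb : 0 < b) (δ : ℕ → ℝ) (hnonneg : ∀ t, 0 ≤ δ t)
    (hrec : ∀ t : ℕ, 1 ≤ t →
      δ (t + 1) ≤ (1 - a * (t : ℝ) ^ (-α)) * δ t + b * (t : ℝ) ^ (-(2 * α))) :
    Filter.limsup (fun t : ℕ => (t : ℝ) ^ α * δ t) Filter.atTop ≤ 4 * (b / a) := by
  have hx : ∀ t : ℕ, 0 ≤ (t : ℝ) ^ α * δ t := fun t =>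
    mul_nonneg (Real.rpow_nonneg t.cast_nonneg _) (hnonneg t)
  have hsmall : ∀ᶠ t : ℕ in Filter.atTop, a * (t : ℝ) ^ (-α) ≤ 1 := by
    have h := ((tendsto_rpow_neg_atTop hα).comp tendsto_natCast_atTop_atTop).const_mul a
    rw [mul_zero] at h
    exact h.eventually (eventually_le_nhds one_pos)
  have hinv : ∀ᶠ t : ℕ in Filter.atTop, (t : ℝ)⁻¹ ≤ a / 4 * (t : ℝ) ^ (-α) := by
    have h := (tendsto_rpow_neg_atTop (sub_pos.2 hα1)).comp tendsto_natCast_atTop_atTop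
    filter_upwards [h.eventually (eventually_le_nhds (show (0 : ℝ) < a / 4 by positivity)),
      Filter.eventually_gt_atTop 0] with t ht ht0
    have ht0' : (0 : ℝ) < t := Nat.cast_pos.2 ht0
    calc (t : ℝ)⁻¹ = (t : ℝ) ^ (-(1 - α)) * (t : ℝ) ^ (-α) := by
          rw [← Real.rpow_add ht0', ← Real.rpow_neg_one]; congr 1; ring
      _ ≤ a / 4 * (t : ℝ) ^ (-α) :=
          mul_le_mul_of_nonneg_right ht (Real.rpow_nonneg ht0'.le _)
  obtain ⟨T, hT⟩ := Filter.eventually_atTop.1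
    ((hsmall.and hinv).and (Filter.eventually_ge_atTop 1))
  have hsum : ¬ Summable fun t : ℕ => 2 * b * (t : ℝ) ^ (-α) := by
    rw [summable_mul_left_iff (by positivity), Real.summable_nat_rpow]
    linarith
  have hev := eventually_le_of_le_max_sub (C := 4 * (b / a)) (T := T) hx
    (fun t => by positivity) hsum fun t ht => by
      obtain ⟨⟨h1, h2⟩, h3⟩ := hT t ht
      push_cast
      exact rescaled_step_le hα hα1 ha hb (Nat.cast_pos.2 h3) (hnonneg _) (hrec t h3) h1 h2
  exact Filter.limsup_le_of_le
    (Filter.isCoboundedUnder_le_of_le Filter.atTop hx) hev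
end

section
/- Let D ∈ ℝ^{n×m} with rank(D) = n ≤ m, x ∈ ℝ^n, 𝓛(z, x) = (1/2)|x − Dz|², and let z* satisfy Dz* = x. Let z_t be the gradient descent iterates z_{t+1} = z_t + ρ D^⊤(x − D z_t) with step ρ ≤ 1/‖D^⊤D‖, and let J_t be their (transposed) Jacobians with respect to x (J_0 = 0, J_{t+1} = J_t(I_m − ρD^⊤D) + ρD as an n×m matrix identity... equivalently obtained by differentiating the recursion). Then g¹_t = x − Dz_t = −D(z_t − z*), g²_t = x − Dz_{2t} = −D(z_{2t} − z*) (so g²_t = g¹_{2t}), and the implicit estimator g³_t, defined with the Moore–Penrose pseudoinverse of ∇_zz𝓛 = D^⊤D, equals 0. -/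
noncomputable section

/-- The kernel of `DᵀD` is the kernel of `D`. -/
theorem apply_eq_zero_of_adjoint_apply_eq_zero {m n : ℕ} (D : Euc m →L[ℝ] Euc n) {u : Euc m}
    (hu : ContinuousLinearMap.adjoint D (D u) = 0) : D u = 0 := by
  rw [← inner_self_eq_zero (𝕜 := ℝ), ← ContinuousLinearMap.adjoint_inner_left, hu,
    inner_zero_left]

/-- If `P` is a generalized inverse of `DᵀD`, then `D P DᵀD = D`. -/
theorem apply_comp_adjoint_comp_self {m n : ℕ} (D : Euc m →L[ℝ] Euc n) (P : Euc m →L[ℝ] Euc m)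
    (hP : ((ContinuousLinearMap.adjoint D).comp D).comp
        (P.comp ((ContinuousLinearMap.adjoint D).comp D))
      = (ContinuousLinearMap.adjoint D).comp D) (w : Euc m) :
    D (P (ContinuousLinearMap.adjoint D (D w))) = D w := by
  have hw := DFunLike.congr_fun hP w
  simp only [ContinuousLinearMap.comp_apply] at hw
  rw [← sub_eq_zero, ← map_sub]
  apply apply_eq_zero_of_adjoint_apply_eq_zero
  rw [map_sub, map_sub, hw, sub_self]

/-- Along gradient descent, the Jacobian `J_t` sends the gradient at step `s` to the decrease of
the residual between the steps `s` and `s + t`. -/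
theorem jacobian_apply_adjoint_residual {m n : ℕ} (D : Euc m →L[ℝ] Euc n) (x : Euc n) (ρ : ℝ)
    (z : ℕ → Euc m) (J : ℕ → Euc m →L[ℝ] Euc n) (hJ0 : J 0 = 0)
    (hzrec : ∀ t, z (t + 1) = z t + ρ • (ContinuousLinearMap.adjoint D) (x - D (z t)))
    (hJrec : ∀ t, J (t + 1) =
      (J t).comp (ContinuousLinearMap.id ℝ (Euc m)
        - ρ • (ContinuousLinearMap.adjoint D).comp D) + ρ • D) (t s : ℕ) :
    J t (ContinuousLinearMap.adjoint D (D (z s) - x)) = D (z s) - D (z (s + t)) := by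
  induction t generalizing s with
  | zero => simp [hJ0]
  | succ t ih =>
    have hres : (ContinuousLinearMap.id ℝ (Euc m) - ρ • (ContinuousLinearMap.adjoint D).comp D)
        (ContinuousLinearMap.adjoint D (D (z s) - x))
        = ContinuousLinearMap.adjoint D (D (z (s + 1)) - x) := by
      simp only [hzrec s, sub_apply, smul_apply,
        ContinuousLinearMap.comp_apply, ContinuousLinearMap.id_apply, map_sub, map_add, map_smul,
        smul_sub]
      abel
    rw [hJrec, add_apply, ContinuousLinearMap.comp_apply, hres, ih (s + 1),
      add_right_comm s 1 t, ← add_assoc, hzrec s]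
    simp only [smul_apply, map_sub, map_add, map_smul, smul_sub]
    abel

/-- the least-squares case `𝓛(z,x) = ½|x − Dz|²`.  For gradient descent
`z_{t+1} = z_t + ρDᵀ(x − Dz_t)` with Jacobians `J₀ = 0`,
`J_{t+1} = J_t(I − ρDᵀD) + ρD`: one has `g¹_t = x − Dz_t = −D(z_t − z*)`,
`g²_t = x − Dz_{2t} = −D(z_{2t} − z*)` and, with `P` the Moore–Penrose pseudoinverse of
`∇_zz𝓛 = DᵀD`, the implicit estimator `g³_t = (x − Dz_t) + DP·∇_z𝓛(z_t)` vanishes. -/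
theorem least_squares_estimators {m n : ℕ}
    (D : Euc m →L[ℝ] Euc n)
    (hrank : LinearMap.range (D : Euc m →ₗ[ℝ] Euc n) = ⊤)  -- rank(D) = n
    (hnm : n ≤ m)
    (x : Euc n) (zstar : Euc m) (hzstar : D zstar = x)
    (ρ : ℝ) (hρ : 0 < ρ)
    (hρle : ρ ≤ 1 / ‖(ContinuousLinearMap.adjoint D).comp D‖)
    (z : ℕ → Euc m) (J : ℕ → Euc m →L[ℝ] Euc n) (hJ0 : J 0 = 0)
    (hzrec : ∀ t, z (t + 1) = z t + ρ • (ContinuousLinearMap.adjoint D) (x - D (z t)))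
    (hJrec : ∀ t, J (t + 1) =
      (J t).comp (ContinuousLinearMap.id ℝ (Euc m)
        - ρ • (ContinuousLinearMap.adjoint D).comp D) + ρ • D)
    -- P is the Moore–Penrose pseudoinverse of A = DᵀD
    (P : Euc m →L[ℝ] Euc m)
    (hP1 : ((ContinuousLinearMap.adjoint D).comp D).comp
        (P.comp ((ContinuousLinearMap.adjoint D).comp D))
      = (ContinuousLinearMap.adjoint D).comp D)
    (hP2 : P.comp (((ContinuousLinearMap.adjoint D).comp D).comp P) = P)
    (hP3 : ContinuousLinearMap.adjoint (((ContinuousLinearMap.adjoint D).comp D).comp P)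
      = ((ContinuousLinearMap.adjoint D).comp D).comp P)
    (hP4 : ContinuousLinearMap.adjoint (P.comp ((ContinuousLinearMap.adjoint D).comp D))
      = P.comp ((ContinuousLinearMap.adjoint D).comp D)) :
    ∀ t : ℕ,
      -- g¹_t = x − Dz_t = −D(z_t − z*)
      (x - D (z t) = -(D (z t - zstar))) ∧
      -- g²_t = g¹_t + J_t ∇_z𝓛(z_t) = x − Dz_{2t} = −D(z_{2t} − z*)
      ((x - D (z t)) + (J t) ((ContinuousLinearMap.adjoint D) (D (z t) - x))
        = x - D (z (2 * t))) ∧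
      (x - D (z (2 * t)) = -(D (z (2 * t) - zstar))) ∧
      -- g³_t = g¹_t + DP ∇_z𝓛(z_t) = 0
      ((x - D (z t)) + (D.comp P) ((ContinuousLinearMap.adjoint D) (D (z t) - x)) = 0) := by
  intro t
  have hneg : ∀ s, x - D (z s) = -(D (z s - zstar)) := fun s => by
    rw [map_sub, hzstar, neg_sub]
  refine ⟨hneg t, ?_, hneg (2 * t), ?_⟩
  · rw [jacobian_apply_adjoint_residual D x ρ z J hJ0 hzrec hJrec t t, two_mul]
    abel
  · have h := apply_comp_adjoint_comp_self D P hP1 (z t - zstar)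
    rw [map_sub, hzstar] at h
    rw [ContinuousLinearMap.comp_apply, h]
    abel
end
end

section
/- Let p ≥ 4 be an even integer, D ∈ ℝ^{n×m} with DD^⊤ = I_n, x ∈ ℝ^n, and 𝓛(z, x) = (1/p) Σ_{i=1}^n (x_i − [Dz]_i)^p. Let z_t be the gradient descent iterates z_{t+1} = z_t + ρ D^⊤ r_t^{p−1} (entrywise power), where r_t = x − Dz_t, with step ρ > 0 such that ρ(p−1)|r_{0,i}|^{p−2} < 1 for each coordinate i, and let J_t be their (transposed) Jacobians with respect to x (J_0 = 0). Set α = (p−1)/(p−2). Then g¹_t = r_t^{p−1} satisfies |g¹_t| = O(t^{−α}), and the automatic estimator satisfies |g²_t| = O(t^{−2α}); the true gradient is g* = 0. -/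
noncomputable section

/-- The Euclidean (`ℓ²`) norm of a vector of `ℝ^k`. -/
noncomputable def euclNorm {k : ℕ} (v : Fin k → ℝ) : ℝ :=
  Real.sqrt (∑ i, v i ^ 2)

open Filter Asymptotics Matrix

theorem euclNorm_le_sum_abs {k : ℕ} (v : Fin k → ℝ) : euclNorm v ≤ ∑ i, |v i| := by
  refine Real.sqrt_le_iff.2 ⟨Finset.sum_nonneg fun i _ => abs_nonneg _, ?_⟩
  calc ∑ i, v i ^ 2 = ∑ i, |v i| ^ 2 := by simp
    _ ≤ (∑ i, |v i|) ^ 2 := Finset.sum_sq_le_sq_sum_of_nonneg fun i _ => abs_nonneg _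

theorem isBigO_euclNorm {α : Type*} {l : Filter α} {k : ℕ} {v : α → Fin k → ℝ} {g : α → ℝ}
    (h : ∀ i, (fun t => v t i) =O[l] g) : (fun t => euclNorm (v t)) =O[l] g := by
  have h1 : (fun t => ∑ i, |v t i|) =O[l] g :=
    IsBigO.fun_sum fun i _ => (h i).abs_left
  refine IsBigO.trans (IsBigO.of_bound 1 (Eventually.of_forall fun t => ?_)) h1
  have h2 : 0 ≤ euclNorm (v t) := Real.sqrt_nonneg _
  rw [one_mul, Real.norm_of_nonneg h2]
  exact (euclNorm_le_sum_abs _).trans (le_abs_self _)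

section Scalar

variable {q : ℕ} {ρ : ℝ} {r : ℕ → ℝ}

theorem residual_mul_pow_bounds (hq : Even q) (hq0 : q ≠ 0) (hρ : 0 < ρ)
    (h0 : ρ * (q + 1) * r 0 ^ q < 1) (hr : ∀ t, r (t + 1) = r t * (1 - ρ * r t ^ q)) (t : ℕ) :
    (q + 1) * (ρ * r t ^ q) < 1 ∧ ρ * r t ^ q * (t + 1) ≤ 1 := by
  have hq1 : (1 : ℝ) ≤ q := by exact_mod_cast Nat.one_le_iff_ne_zero.2 hq0
  induction t with
  | zero =>
    have hw : 0 ≤ ρ * r 0 ^ q := mul_nonneg hρ.le (hq.pow_nonneg _)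
    refine ⟨by linarith, ?_⟩
    push_cast
    nlinarith
  | succ t ih =>
    obtain ⟨ih1, ih2⟩ := ih
    have hw : 0 ≤ ρ * r t ^ q := mul_nonneg hρ.le (hq.pow_nonneg _)
    have hstep : ρ * r (t + 1) ^ q = ρ * r t ^ q * (1 - ρ * r t ^ q) ^ q := by
      rw [hr, mul_pow, mul_assoc]
    rw [hstep]
    generalize ρ * r t ^ q = w at *
    have hw1 : w ≤ 1 := by nlinarith
    have hle : w * (1 - w) ^ q ≤ w * (1 - w) :=
      mul_le_mul_of_nonneg_left (pow_le_of_le_one (by linarith) (by linarith) hq0) hw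
    constructor
    · have : w * (1 - w) ^ q ≤ w := hle.trans (by nlinarith)
      nlinarith
    · have ht : (0 : ℝ) ≤ t := t.cast_nonneg
      have : w * (1 - w) * (t + 2) ≤ 1 := by
        nlinarith [mul_nonneg (sub_nonneg.2 ih2) (sub_nonneg.2 hw1), sq_nonneg w]
      push_cast
      nlinarith

theorem residual_pow_isBigO (hq : Even q) (hq0 : q ≠ 0) (hρ : 0 < ρ)
    (h0 : ρ * (q + 1) * r 0 ^ q < 1) (hr : ∀ t, r (t + 1) = r t * (1 - ρ * r t ^ q)) :
    (fun t => r t ^ (q + 1)) =O[atTop] fun t : ℕ => (t : ℝ) ^ (-(((q : ℝ) + 1) / q)) := by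
  refine IsBigO.of_bound (ρ ^ (-(((q : ℝ) + 1) / q))) ?_
  filter_upwards [eventually_gt_atTop 0] with t ht
  have ht' : (0 : ℝ) < t := by exact_mod_cast ht
  have hq' : (0 : ℝ) < q := by exact_mod_cast Nat.pos_of_ne_zero hq0
  have hb := (residual_mul_pow_bounds hq hq0 hρ h0 hr t).2
  have hw : 0 ≤ ρ * r t ^ q := mul_nonneg hρ.le (hq.pow_nonneg _)
  have hle : r t ^ q ≤ (ρ * t)⁻¹ := by
    rw [← one_div, le_div_iff₀ (by positivity)]
    nlinarith
  rw [Real.norm_of_nonneg (by positivity : (0 : ℝ) ≤ (t : ℝ) ^ (-(((q : ℝ) + 1) / q))),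
    ← Real.mul_rpow hρ.le ht'.le, Real.norm_eq_abs, abs_pow]
  calc |r t| ^ (q + 1) = (|r t| ^ q) ^ (((q : ℝ) + 1) / q) := by
        rw [← Real.rpow_natCast, ← Real.rpow_natCast, ← Real.rpow_mul (abs_nonneg _)]
        congr 1
        push_cast
        field_simp
    _ ≤ ((ρ * t)⁻¹) ^ (((q : ℝ) + 1) / q) := by
        rw [hq.pow_abs]
        exact Real.rpow_le_rpow (hq.pow_nonneg _) hle (by positivity)
    _ = (ρ * t) ^ (-(((q : ℝ) + 1) / q)) := by
        rw [Real.rpow_neg (by positivity), Real.inv_rpow (by positivity)]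

theorem residual_deriv_bounds (hq : Even q) (hq0 : q ≠ 0) (hρ : 0 < ρ)
    (h0 : ρ * (q + 1) * r 0 ^ q < 1) (hr : ∀ t, r (t + 1) = r t * (1 - ρ * r t ^ q))
    (t : ℕ) :
    0 ≤ ∏ k ∈ Finset.range t, (1 - (q + 1) * ρ * r k ^ q) ∧
    (∏ k ∈ Finset.range t, (1 - (q + 1) * ρ * r k ^ q)) * |r 0| ^ (q + 1) ≤ |r t| ^ (q + 1) := by
  induction t with
  | zero => simp
  | succ t ih =>
    obtain ⟨ih1, ih2⟩ := ih
    have hb := (residual_mul_pow_bounds hq hq0 hρ h0 hr t).1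
    have hq1 : (1 : ℝ) ≤ q := by exact_mod_cast Nat.one_le_iff_ne_zero.2 hq0
    have hw : 0 ≤ ρ * r t ^ q := mul_nonneg hρ.le (hq.pow_nonneg _)
    have hw1 : ρ * r t ^ q ≤ 1 := by nlinarith
    have hnn : 0 ≤ 1 - (q + 1) * ρ * r t ^ q := by linarith
    rw [Finset.prod_range_succ]
    refine ⟨mul_nonneg ih1 hnn, ?_⟩
    have bern : 1 - (q + 1) * ρ * r t ^ q ≤ (1 - ρ * r t ^ q) ^ (q + 1) := by
      have := one_add_mul_le_pow (a := -(ρ * r t ^ q)) (by linarith) (q + 1)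
      rw [← sub_eq_add_neg] at this
      push_cast at this
      linarith
    calc _ = ((∏ k ∈ Finset.range t, (1 - (q + 1) * ρ * r k ^ q)) * |r 0| ^ (q + 1)) *
          (1 - (q + 1) * ρ * r t ^ q) := by ring
      _ ≤ |r t| ^ (q + 1) * (1 - ρ * r t ^ q) ^ (q + 1) :=
          mul_le_mul ih2 bern hnn (by positivity)
      _ = |r (t + 1)| ^ (q + 1) := by
          rw [hr, abs_mul, mul_pow, abs_of_nonneg (sub_nonneg.2 hw1)]

theorem residual_deriv_mul_isBigO (hq : Even q) (hq0 : q ≠ 0) (hρ : 0 < ρ)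
    (h0 : ρ * (q + 1) * r 0 ^ q < 1) (hr : ∀ t, r (t + 1) = r t * (1 - ρ * r t ^ q)) :
    (fun t => (∏ k ∈ Finset.range t, (1 - (q + 1) * ρ * r k ^ q)) * r t ^ (q + 1))
      =O[atTop] fun t : ℕ => (t : ℝ) ^ (-(2 * (((q : ℝ) + 1) / q))) := by
  have hO := residual_pow_isBigO hq hq0 hρ h0 hr
  have hg : (fun t : ℕ => (t : ℝ) ^ (-(((q : ℝ) + 1) / q)) * (t : ℝ) ^ (-(((q : ℝ) + 1) / q)))
      =ᶠ[atTop] fun t : ℕ => (t : ℝ) ^ (-(2 * (((q : ℝ) + 1) / q))) := by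
    filter_upwards [eventually_gt_atTop 0] with t ht
    rw [← Real.rpow_add (by exact_mod_cast ht)]
    ring_nf
  refine (IsBigO.trans ?_ (hO.mul hO)).trans_eventuallyEq hg
  refine IsBigO.of_bound (|r 0| ^ (q + 1))⁻¹ (Eventually.of_forall fun t => ?_)
  obtain ⟨hnn, hle⟩ := residual_deriv_bounds hq hq0 hρ h0 hr t
  rw [norm_mul, norm_mul, Real.norm_of_nonneg hnn, Real.norm_eq_abs, abs_pow, ← mul_assoc]
  by_cases hz : r 0 = 0
  · have : r t = 0 := by
      clear hle hnn
      induction t with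
      | zero => exact hz
      | succ t ih => rw [hr, ih, zero_mul]
    simp [this]
  · refine mul_le_mul_of_nonneg_right ?_ (by positivity)
    rw [inv_mul_eq_div, le_div_iff₀ (by positivity)]
    exact hle

end Scalar

/-- least mean `p`-th problem `𝓛(z,x) = (1/p)∑ᵢ(xᵢ − [Dz]ᵢ)^p` with `p ≥ 4`
even and `DDᵀ = Iₙ`.  For gradient descent `z_{t+1} = z_t + ρDᵀr_t^{p−1}` (`r_t = x − Dz_t`)
with Jacobians `J₀ = 0`, `J_{t+1} = J_t + (p−1)ρ(Iₙ − J_tDᵀ)diag(r_t^{p−2})D`, and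
`α = (p−1)/(p−2)`, the analytic estimator `g¹_t = r_t^{p−1}` satisfies `|g¹_t| = O(t^{−α})`
and the automatic estimator `g²_t = g¹_t + J_t∇_z𝓛(z_t)` satisfies `|g²_t| = O(t^{−2α})`
(the true gradient being `g* = 0`). -/
theorem least_pth_estimators {m n : ℕ} (p : ℕ) (hp : 4 ≤ p) (hpeven : Even p)
    (D : Matrix (Fin n) (Fin m) ℝ) (hD : D * D.transpose = 1)
    (x : Fin n → ℝ) (ρ : ℝ) (hρ : 0 < ρ)
    (z : ℕ → Fin m → ℝ) (J : ℕ → Matrix (Fin n) (Fin m) ℝ) (hJ0 : J 0 = 0)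
    (hstep : ∀ i, ρ * ((p : ℝ) - 1) * |x i - D.mulVec (z 0) i| ^ (p - 2) < 1)
    (hzrec : ∀ t, z (t + 1)
      = z t + ρ • D.transpose.mulVec fun i => (x i - D.mulVec (z t) i) ^ (p - 1))
    (hJrec : ∀ t, J (t + 1)
      = J t + (((p : ℝ) - 1) * ρ) •
          ((1 - J t * D.transpose)
            * Matrix.diagonal (fun i => (x i - D.mulVec (z t) i) ^ (p - 2)) * D)) :
    -- |g¹_t| = O(t^{−α}) with α = (p−1)/(p−2)
    ((fun t : ℕ => euclNorm fun i => (x i - D.mulVec (z t) i) ^ (p - 1))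
        =O[Filter.atTop] fun t : ℕ => (t : ℝ) ^ (-(((p : ℝ) - 1) / ((p : ℝ) - 2)))) ∧
    -- |g²_t| = O(t^{−2α})
    ((fun t : ℕ => euclNorm
        ((fun i => (x i - D.mulVec (z t) i) ^ (p - 1))
          + (J t).mulVec
            (-(D.transpose.mulVec fun i => (x i - D.mulVec (z t) i) ^ (p - 1)))))
        =O[Filter.atTop] fun t : ℕ => (t : ℝ) ^ (-(2 * (((p : ℝ) - 1) / ((p : ℝ) - 2))))) := by
  obtain ⟨q, rfl⟩ : ∃ q, p = q + 2 := ⟨p - 2, by omega⟩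
  have hq : Even q := by simpa [Nat.even_add] using hpeven
  have hq0 : q ≠ 0 := by omega
  have e1 : ((q + 2 : ℕ) : ℝ) - 1 = q + 1 := by push_cast; ring
  have e2 : ((q + 2 : ℕ) : ℝ) - 2 = q := by push_cast; ring
  have e3 : q + 2 - 1 = q + 1 := rfl
  have e4 : q + 2 - 2 = q := rfl
  simp only [e1, e2, e3, e4, hq.pow_abs] at hstep hzrec hJrec ⊢
  set r : Fin n → ℕ → ℝ := fun i t => x i - D.mulVec (z t) i with hrdef
  have hr : ∀ i t, r i (t + 1) = r i t * (1 - ρ * r i t ^ q) := by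
    intro i t
    simp only [hrdef, hzrec t, mulVec_add, mulVec_smul, mulVec_mulVec, hD, one_mulVec,
      Pi.add_apply, Pi.smul_apply, smul_eq_mul]
    ring
  have hA : ∀ t, 1 - J t * D.transpose =
      diagonal fun i => ∏ k ∈ Finset.range t, (1 - (q + 1) * ρ * r i k ^ q) := by
    intro t
    induction t with
    | zero => simp [hJ0]
    | succ t ih =>
      rw [hJrec, Matrix.add_mul (J t), Matrix.smul_mul, Matrix.mul_assoc _ D, hD, Matrix.mul_one, ← sub_sub, ih,
        diagonal_mul_diagonal, ← diagonal_smul, diagonal_sub]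
      congr 1
      funext i
      simp only [Finset.prod_range_succ, Pi.smul_apply, smul_eq_mul, hrdef]
      ring
  refine ⟨isBigO_euclNorm fun i => residual_pow_isBigO hq hq0 hρ (hstep i) (hr i),
    isBigO_euclNorm fun i => ?_⟩
  have hg : ∀ t, (fun i => (x i - D.mulVec (z t) i) ^ (q + 1)) +
      (J t).mulVec (-(D.transpose.mulVec fun i => (x i - D.mulVec (z t) i) ^ (q + 1))) =
      (1 - J t * D.transpose).mulVec fun i => (x i - D.mulVec (z t) i) ^ (q + 1) := by
    intro t
    rw [sub_mulVec, one_mulVec, mulVec_neg, mulVec_mulVec, sub_eq_add_neg]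
  simp only [hg, hA, mulVec_diagonal]
  exact residual_deriv_mul_isBigO hq hq0 hρ (hstep i) (hr i)
end
end

section
/- Let p ≥ 3 be an integer, ρ > 0 and u_0 > 0 with ρ(p−1)u_0^{p−2} < 1, and define u_{t+1} = u_t − ρ u_t^{p−1}. Then u_t is positive, strictly decreasing to 0, and satisfies the asymptotic expansion u_t = (ρ(p−2)t)^{−1/(p−2)} (1 + O(log(t)/t)); i.e., there exist C > 0 and T such that |u_t · (ρ(p−2)t)^{1/(p−2)} − 1| ≤ C log(t)/t for all t ≥ T. -/
/-- Lower increment bound for the reciprocal power along `x ↦ x (1 - ρ x ^ m)`. -/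
lemma inv_pow_add_le_inv_pow_step {m : ℕ} {ρ x : ℝ} (hρ : 0 < ρ) (hx : 0 < x)
    (h : ρ * x ^ m < 1) :
    (x ^ m)⁻¹ + m * ρ ≤ ((x * (1 - ρ * x ^ m)) ^ m)⁻¹ := by
  have hxm : 0 < x ^ m := pow_pos hx m
  set y := ρ * x ^ m with hy
  have hy0 : 0 < y := mul_pos hρ hxm
  have hq : 0 < (1 - y) ^ m := pow_pos (by linarith) m
  have bern : 1 + m * y ≤ (1 + y) ^ m := one_add_mul_le_pow (by linarith) m
  have hprod : (1 - y) ^ m * (1 + y) ^ m ≤ 1 := by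
    rw [← mul_pow]
    exact pow_le_one₀ (by nlinarith) (by nlinarith)
  have hle : 1 + m * y ≤ ((1 - y) ^ m)⁻¹ := by
    rw [le_inv_comm₀ (by positivity) hq, inv_eq_one_div, le_div_iff₀ (by positivity)]
    exact (mul_le_mul_of_nonneg_left bern hq.le).trans hprod
  rw [mul_pow, mul_inv]
  calc (x ^ m)⁻¹ + m * ρ = (x ^ m)⁻¹ * (1 + m * y) := by
        rw [hy]; field_simp
    _ ≤ _ := mul_le_mul_of_nonneg_left hle (by positivity)

/-- Upper increment bound for the reciprocal power along `x ↦ x (1 - ρ x ^ m)`. -/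
lemma inv_pow_step_le {m : ℕ} {ρ x : ℝ} (hρ : 0 < ρ) (hx : 0 < x)
    (h : ρ * (m + 1) * x ^ m < 1) :
    ((x * (1 - ρ * x ^ m)) ^ m)⁻¹ ≤
      (x ^ m)⁻¹ + m * ρ + m ^ 2 * (m + 1) * ρ ^ 2 * x ^ m := by
  have hxm : 0 < x ^ m := pow_pos hx m
  have hm : (0 : ℝ) ≤ m := m.cast_nonneg
  set y := ρ * x ^ m with hy
  have hy0 : 0 < y := mul_pos hρ hxm
  have hy1 : (m + 1) * y < 1 := by rw [hy]; linarith
  have hmy : 0 < 1 - m * y := by linarith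
  have bern : 1 - m * y ≤ (1 - y) ^ m := by
    have := one_add_mul_le_pow (a := -y) (by nlinarith) m
    simpa [sub_eq_add_neg] using this
  have hle : ((1 - y) ^ m)⁻¹ ≤ 1 + m * y + m ^ 2 * (m + 1) * y ^ 2 := by
    refine (inv_anti₀ hmy bern).trans ?_
    rw [inv_eq_one_div, div_le_iff₀ hmy]
    have key : 0 ≤ (m : ℝ) ^ 3 * y ^ 2 * (1 - (m + 1) * y) :=
      mul_nonneg (by positivity) (by linarith)
    linear_combination key
  rw [mul_pow, mul_inv]
  calc (x ^ m)⁻¹ * ((1 - y) ^ m)⁻¹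
      ≤ (x ^ m)⁻¹ * (1 + m * y + m ^ 2 * (m + 1) * y ^ 2) :=
        mul_le_mul_of_nonneg_left hle (by positivity)
    _ = _ := by rw [hy]; field_simp

/-- A sequence whose increments exceed `c` by at most `K / t` grows like `c t + O(log t)`. -/
lemma le_linear_add_log_of_step_le {v : ℕ → ℝ} {c K : ℝ} (hK : 0 ≤ K)
    (hv : ∀ t : ℕ, 1 ≤ t → v (t + 1) ≤ v t + c + K / t) (t : ℕ) (ht : 1 ≤ t) :
    v t ≤ c * t + (v 1 - c) + 2 * K * Real.log t := by
  induction t, ht using Nat.le_induction with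
  | base => simp
  | succ t ht ih =>
    have ht' : (1 : ℝ) ≤ t := by exact_mod_cast ht
    have ht0 : (0 : ℝ) < t := by linarith
    have hlog : 1 / (2 * (t : ℝ)) ≤ Real.log (t + 1) - Real.log t := by
      rw [← Real.log_div (by positivity) (by positivity)]
      refine le_trans ?_ (Real.one_sub_inv_le_log_of_pos (by positivity))
      have : 1 - (((t : ℝ) + 1) / t)⁻¹ = 1 / (t + 1) := by field_simp; ring
      rw [this]
      exact one_div_le_one_div_of_le (by positivity) (by linarith)
    have hK' : K / t ≤ 2 * K * (Real.log (t + 1) - Real.log t) := by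
      refine le_trans (le_of_eq ?_) (mul_le_mul_of_nonneg_left hlog (by positivity))
      field_simp
    have := hv t ht
    push_cast
    linarith

/-- If `z ^ m = w⁻¹` with `w ≥ 1`, then `z` is at least as close to `1` as `w` is. -/
lemma abs_sub_one_le_of_pow_eq_inv {m : ℕ} (hm : m ≠ 0) {z w : ℝ} (hz : 0 ≤ z) (hw : 1 ≤ w)
    (h : z ^ m = w⁻¹) : |z - 1| ≤ w - 1 := by
  have hz1 : z ≤ 1 := (pow_le_one_iff_of_nonneg hz hm).1 (h ▸ inv_le_one_of_one_le₀ hw)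
  have hzm : z ^ m ≤ z := pow_le_of_le_one hz hz1 hm
  have hinv : 1 - w⁻¹ ≤ w - 1 := by
    have h0 : 0 < w := by linarith
    have : w * w⁻¹ = 1 := mul_inv_cancel₀ h0.ne'
    nlinarith [inv_pos.2 h0, sq_nonneg (w - 1)]
  rw [abs_of_nonpos (by linarith)]
  linarith


/-- the one-dimensional recursion `u_{t+1} = u_t − ρu_t^{p−1}` with `p ≥ 3`,
`u₀ > 0` and `ρ(p−1)u₀^{p−2} < 1` is positive, strictly decreasing to `0`, and satisfies
`u_t = (ρ(p−2)t)^{−1/(p−2)}(1 + O(log t / t))`. -/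
theorem one_dim_recursion_asymptotics (p : ℕ) (hp : 3 ≤ p) (ρ u0 : ℝ)
    (hρ : 0 < ρ) (hu0 : 0 < u0) (hstep : ρ * ((p : ℝ) - 1) * u0 ^ (p - 2) < 1)
    (u : ℕ → ℝ) (h0 : u 0 = u0) (hrec : ∀ t, u (t + 1) = u t - ρ * u t ^ (p - 1)) :
    (∀ t, 0 < u t) ∧ StrictAnti u ∧ Filter.Tendsto u Filter.atTop (nhds 0) ∧
      ∃ C > 0, ∃ T : ℕ, ∀ t : ℕ, T ≤ t →
        |u t * (ρ * ((p : ℝ) - 2) * t) ^ ((1 : ℝ) / ((p : ℝ) - 2)) - 1|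
          ≤ C * Real.log t / t := by
  obtain ⟨m, rfl⟩ : ∃ m, p = m + 2 := ⟨p - 2, by omega⟩
  have hm : 1 ≤ m := by omega
  have hm0 : m ≠ 0 := by omega
  have hmR : (1 : ℝ) ≤ m := by exact_mod_cast hm
  have e1 : ((m + 2 : ℕ) : ℝ) - 1 = m + 1 := by push_cast; ring
  have e2 : ((m + 2 : ℕ) : ℝ) - 2 = m := by push_cast; ring
  have e3 : m + 2 - 1 = m + 1 := by omega
  rw [e1, Nat.add_sub_cancel] at hstep
  rw [e2]
  have hrec' : ∀ t, u (t + 1) = u t * (1 - ρ * u t ^ m) := fun t => by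
    rw [hrec, e3]; ring
  have small : ∀ x : ℝ, 0 < x → ρ * (m + 1) * x ^ m < 1 → ρ * x ^ m < 1 := fun x hx h => by
    nlinarith [mul_pos hρ (pow_pos hx m)]
  have inv : ∀ t, 0 < u t ∧ ρ * (m + 1) * u t ^ m < 1 := fun t => by
    induction t with
    | zero => rw [h0]; exact ⟨hu0, hstep⟩
    | succ t ih =>
      obtain ⟨hpos, hlt⟩ := ih
      have hs := small _ hpos hlt
      have hy : 0 < ρ * u t ^ m := mul_pos hρ (pow_pos hpos m)
      have hpos' : 0 < u (t + 1) := hrec' t ▸ mul_pos hpos (by linarith)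
      have hle : u (t + 1) ≤ u t := by rw [hrec']; nlinarith
      refine ⟨hpos', lt_of_le_of_lt ?_ hlt⟩
      gcongr
  have hpos : ∀ t, 0 < u t := fun t => (inv t).1
  have hlow : ∀ t : ℕ, m * ρ * t ≤ (u t ^ m)⁻¹ := fun t => by
    induction t with
    | zero => simpa using (pow_pos (hpos 0) m).le
    | succ t ih =>
      have := inv_pow_add_le_inv_pow_step hρ (hpos t) (small _ (hpos t) (inv t).2)
      rw [hrec']
      push_cast
      linarith
  have hmρ : 0 < m * ρ := by positivity
  refine ⟨hpos, strictAnti_nat_of_succ_lt fun t => ?_, ?_, ?_⟩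
  · rw [hrec]
    linarith [mul_pos hρ (pow_pos (hpos t) (m + 2 - 1))]
  · have hlim : Filter.Tendsto (fun t => u t ^ m) Filter.atTop (nhds 0) := by
      have htop : Filter.Tendsto (fun t => (u t ^ m)⁻¹) Filter.atTop Filter.atTop :=
        Filter.tendsto_atTop_mono hlow
          (tendsto_natCast_atTop_atTop.const_mul_atTop hmρ)
      exact htop.inv_tendsto_atTop.congr fun t => inv_inv _
    have hroot := hlim.rpow_const (p := (m : ℝ)⁻¹) (Or.inr (by positivity))
    rw [Real.zero_rpow (by positivity)] at hroot
    exact hroot.congr fun t => Real.pow_rpow_inv_natCast (hpos t).le hm0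
  · set K : ℝ := m ^ 2 * (m + 1) * ρ ^ 2 / (m * ρ) with hK
    have hK0 : 0 ≤ K := by positivity
    have hup := le_linear_add_log_of_step_le (v := fun t => (u t ^ m)⁻¹) (c := m * ρ) hK0
      fun t ht => by
        have ht0 : (0 : ℝ) < t := by exact_mod_cast ht
        have h1 := inv_pow_step_le hρ (hpos t) (inv t).2
        have h2 : u t ^ m ≤ (m * ρ * t)⁻¹ := by
          rw [le_inv_comm₀ (pow_pos (hpos t) m) (by positivity)]
          exact hlow t
        have h3 : (m : ℝ) ^ 2 * (m + 1) * ρ ^ 2 * u t ^ m ≤ K / t := by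
          refine (mul_le_mul_of_nonneg_left h2 (by positivity)).trans (le_of_eq ?_)
          rw [hK]; field_simp
        simp only [hrec' t]
        linarith
    set A : ℝ := (u 1 ^ m)⁻¹ with hA
    have hA0 : 0 < A := inv_pos.2 (pow_pos (hpos 1) m)
    refine ⟨(A + 2 * K) / (m * ρ), by positivity, 3, fun t ht => ?_⟩
    have ht3 : (3 : ℝ) ≤ t := by exact_mod_cast ht
    have ht0 : (0 : ℝ) < t := by linarith
    have hlog : 1 ≤ Real.log t := by
      rw [Real.le_log_iff_exp_le ht0]
      linarith [Real.exp_one_lt_d9]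
    have hs : 0 < m * ρ * t := by positivity
    have hum : 0 < u t ^ m := pow_pos (hpos t) m
    refine (abs_sub_one_le_of_pow_eq_inv hm0 (w := (u t ^ m)⁻¹ / (m * ρ * t))
      (mul_nonneg (hpos t).le (by positivity)) ?_ ?_).trans ?_
    · rw [le_div_iff₀ hs, one_mul]
      exact hlow t
    · rw [mul_pow, one_div, Real.rpow_inv_natCast_pow (by positivity) hm0, inv_div, div_inv_eq_mul]
      ring
    · have h1 := hup t (by omega)
      have h2 : (u t ^ m)⁻¹ - m * ρ * t ≤ (A + 2 * K) * Real.log t := by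
        nlinarith
      calc (u t ^ m)⁻¹ / (m * ρ * t) - 1 = ((u t ^ m)⁻¹ - m * ρ * t) / (m * ρ * t) := by
            rw [sub_div, div_self hs.ne']
        _ ≤ (A + 2 * K) * Real.log t / (m * ρ * t) := by gcongr
        _ = (A + 2 * K) / (m * ρ) * Real.log t / t := by field_simp
end

section
/- Let ℓ : ℝ^n → ℝ be μ_x-strongly convex and L_x-smooth with minimizer x*, and let g : ℝ^n → ℝ^n satisfy |g(x) − ∇ℓ(x)| ≤ Δ for all x. Then the inexact gradient descent iterates x_{q+1} = x_q − (1/(2L_x)) g(x_q) satisfy, for all q, ℓ(x_q) − ℓ(x*) ≤ 2L_x (1 − μ_x/(4L_x))^q |x_0 − x*|² + δ, where δ = Δ²(1/μ_x + 1/(2L_x)). -/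
noncomputable section

section InexactGradientDescent

open Set Filter Topology

variable {E : Type*} [NormedAddCommGroup E] [InnerProductSpace ℝ E] [CompleteSpace E]
  {f : E → ℝ}

theorem hasDerivAt_comp_line (hf : Differentiable ℝ f) (x d : E) (t : ℝ) :
    HasDerivAt (fun s : ℝ => f (x + s • d)) (inner ℝ (gradient f (x + t • d)) d) t := by
  have hline : HasDerivAt (fun s : ℝ => x + s • d) d t := by
    simpa using ((hasDerivAt_id t).smul_const d).const_add x
  have h := (hf (x + t • d)).hasGradientAt.hasFDerivAt.comp_hasDerivAt t hline
  rwa [InnerProductSpace.toDual_apply_apply] at h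

/-- The descent lemma for a function with `L`-Lipschitz gradient. -/
theorem le_add_inner_gradient_add_sq {L : ℝ} (hf : Differentiable ℝ f)
    (hL : ∀ a b : E, ‖gradient f a - gradient f b‖ ≤ L * ‖a - b‖) (x d : E) :
    f (x + d) ≤ f x + inner ℝ (gradient f x) d + L / 2 * ‖d‖ ^ 2 := by
  have hderiv (t : ℝ) : HasDerivAt
      (fun s : ℝ => f (x + s • d) - s * inner ℝ (gradient f x) d - s ^ 2 * (L / 2 * ‖d‖ ^ 2))
      (inner ℝ (gradient f (x + t • d)) d - inner ℝ (gradient f x) d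
        - 2 * t * (L / 2 * ‖d‖ ^ 2)) t := by
    have h1 := hasDerivAt_comp_line hf x d t
    have h2 := (hasDerivAt_id t).mul_const (inner ℝ (gradient f x) d : ℝ)
    have h3 := (hasDerivAt_pow 2 t).mul_const (L / 2 * ‖d‖ ^ 2)
    refine ((h1.sub h2).sub h3).congr_deriv ?_
    norm_num
  have hanti := antitoneOn_of_deriv_nonpos (convex_Icc (0 : ℝ) 1)
    (fun t _ => (hderiv t).continuousAt.continuousWithinAt)
    (fun t _ => (hderiv t).differentiableAt.differentiableWithinAt)
    (fun t ht => by
      rw [interior_Icc] at ht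
      rw [(hderiv t).deriv, ← inner_sub_left]
      have h1 := real_inner_le_norm (gradient f (x + t • d) - gradient f x) d
      have h2 := hL (x + t • d) x
      rw [add_sub_cancel_left, norm_smul, Real.norm_of_nonneg ht.1.le] at h2
      have h3 := mul_le_mul_of_nonneg_right h2 (norm_nonneg d)
      linarith)
  have h := hanti (left_mem_Icc.2 zero_le_one) (right_mem_Icc.2 zero_le_one) zero_le_one
  simp only [one_smul, zero_smul, add_zero, one_pow, one_mul, zero_mul, sub_zero,
    zero_pow two_ne_zero] at h
  linarith

/-- The first-order characterization of strong convexity. -/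
theorem StrongConvexOn.add_inner_gradient_add_sq_le {m : ℝ}
    (hsc : StrongConvexOn univ m f) (hf : Differentiable ℝ f) (x d : E) :
    f x + inner ℝ (gradient f x) d + m / 2 * ‖d‖ ^ 2 ≤ f (x + d) := by
  have hslope : Tendsto (fun t : ℝ => t⁻¹ * (f (x + t • d) - f x)) (𝓝[>] 0)
      (𝓝 (inner ℝ (gradient f x) d)) := by
    have h := (hasDerivAt_comp_line hf x d 0).tendsto_slope_zero_right
    simpa using h
  have hbound : Tendsto (fun t : ℝ => f (x + d) - f x - (1 - t) * (m / 2 * ‖d‖ ^ 2)) (𝓝[>] 0)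
      (𝓝 (f (x + d) - f x - (1 - 0) * (m / 2 * ‖d‖ ^ 2))) := by
    apply tendsto_nhdsWithin_of_tendsto_nhds
    apply Continuous.tendsto
    fun_prop
  have h := le_of_tendsto_of_tendsto hslope hbound (by
    filter_upwards [Ioo_mem_nhdsGT (zero_lt_one' ℝ)] with t ht
    have h := hsc.2 (mem_univ x) (mem_univ (x + d)) (sub_nonneg.2 ht.2.le) ht.1.le
      (sub_add_cancel 1 t)
    have hpt : (1 - t) • x + t • (x + d) = x + t • d := by module
    rw [hpt, sub_add_cancel_left, norm_neg] at h
    simp only [smul_eq_mul] at h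
    rw [inv_mul_le_iff₀ ht.1]
    linarith)
  linarith

/-- The Polyak–Łojasiewicz inequality for strongly convex functions. -/
theorem StrongConvexOn.two_mul_sub_le_norm_gradient_sq {m : ℝ} (hm : 0 < m)
    (hsc : StrongConvexOn univ m f) (hf : Differentiable ℝ f) (x y : E) :
    2 * m * (f x - f y) ≤ ‖gradient f x‖ ^ 2 := by
  have h := hsc.add_inner_gradient_add_sq_le hf x (y - x)
  rw [add_sub_cancel] at h
  have hsq := norm_add_sq_real (gradient f x) (m • (y - x))
  rw [real_inner_smul_right, norm_smul, Real.norm_of_nonneg hm.le] at hsq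
  have h2 := sq_nonneg ‖gradient f x + m • (y - x)‖
  have h3 := mul_le_mul_of_nonneg_left h hm.le
  nlinarith

theorem gradient_eq_zero_of_forall_le {x : E} (hmin : ∀ y, f x ≤ f y) : gradient f x = 0 := by
  have h : IsLocalMin f x := Eventually.of_forall hmin
  simp [gradient, h.fderiv_eq_zero]

/-- One step of gradient descent with step size `1 / (2 * L)` along an inexact gradient `v`. -/
theorem inexact_gradient_step_le {L Δ : ℝ} (hL : 0 < L) (hf : Differentiable ℝ f)
    (hlip : ∀ a b : E, ‖gradient f a - gradient f b‖ ≤ L * ‖a - b‖) (x v : E)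
    (hv : ‖v - gradient f x‖ ≤ Δ) :
    f (x - (1 / (2 * L)) • v) ≤ f x + (Δ ^ 2 - ‖gradient f x‖ ^ 2) / (4 * L) := by
  have h := le_add_inner_gradient_add_sq hf hlip x (-((1 / (2 * L)) • v))
  rw [← sub_eq_add_neg, inner_neg_right, real_inner_smul_right, norm_neg, norm_smul,
    Real.norm_of_nonneg (by positivity)] at h
  have hsub := norm_sub_sq_real v (gradient f x)
  rw [real_inner_comm] at hsub
  have hΔ : ‖v - gradient f x‖ ^ 2 ≤ Δ ^ 2 := pow_le_pow_left₀ (norm_nonneg _) hv 2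
  have hv2 := sq_nonneg ‖v‖
  have key : (‖v‖ ^ 2 / 2 - 2 * inner ℝ (gradient f x) v) / (4 * L)
      ≤ (Δ ^ 2 - ‖gradient f x‖ ^ 2) / (4 * L) := by
    apply div_le_div_of_nonneg_right _ (by positivity)
    linarith
  have hrw : f x + -(1 / (2 * L) * inner ℝ (gradient f x) v) + L / 2 * (1 / (2 * L) * ‖v‖) ^ 2
      = f x + (‖v‖ ^ 2 / 2 - 2 * inner ℝ (gradient f x) v) / (4 * L) := by
    field_simp
    ring
  linarith

end InexactGradientDescent

/-- inexact gradient descent on a `μₓ`-strongly convex, `Lₓ`-smooth function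
with uniformly `Δ`-accurate gradient estimates: the iterates
`x_{q+1} = x_q − (1/(2Lₓ))g(x_q)` satisfy
`ℓ(x_q) − ℓ(x*) ≤ 2Lₓ(1 − μₓ/(4Lₓ))^q |x₀ − x*|² + δ` with `δ = Δ²(1/μₓ + 1/(2Lₓ))`. -/
theorem inexact_gradient_descent {n : ℕ} (ℓ : Euc n → ℝ) (μx Lx Δ : ℝ)
    (hμ : 0 < μx) (hLx : 0 < Lx) (hΔ : 0 ≤ Δ)
    (hdiff : Differentiable ℝ ℓ)
    (hsc : StrongConvexOn Set.univ μx ℓ)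
    (hsmooth : ∀ a b : Euc n, ‖gradient ℓ a - gradient ℓ b‖ ≤ Lx * ‖a - b‖)
    (xstar : Euc n) (hmin : ∀ y, ℓ xstar ≤ ℓ y)
    (g : Euc n → Euc n) (hg : ∀ y, ‖g y - gradient ℓ y‖ ≤ Δ)
    (X : ℕ → Euc n) (hrec : ∀ q, X (q + 1) = X q - (1 / (2 * Lx)) • g (X q)) :
    ∀ q : ℕ, ℓ (X q) - ℓ xstar
      ≤ 2 * Lx * (1 - μx / (4 * Lx)) ^ q * ‖X 0 - xstar‖ ^ 2
        + Δ ^ 2 * (1 / μx + 1 / (2 * Lx)) := by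
  have hgrad : gradient ℓ xstar = 0 := gradient_eq_zero_of_forall_le hmin
  have hupper (y : Euc n) : ℓ y - ℓ xstar ≤ Lx / 2 * ‖y - xstar‖ ^ 2 := by
    have h := le_add_inner_gradient_add_sq hdiff hsmooth xstar (y - xstar)
    rw [add_sub_cancel, hgrad, inner_zero_left] at h
    linarith
  have hlower (y : Euc n) : μx / 2 * ‖y - xstar‖ ^ 2 ≤ ℓ y - ℓ xstar := by
    have h := hsc.add_inner_gradient_add_sq_le hdiff xstar (y - xstar)
    rw [add_sub_cancel, hgrad, inner_zero_left] at h
    linarith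
  have hδ : 0 ≤ Δ ^ 2 * (1 / μx + 1 / (2 * Lx)) := by positivity
  rcases le_or_gt μx Lx with hle | hlt
  · have hρ : 0 ≤ 1 - μx / (4 * Lx) := by
      rw [sub_nonneg, div_le_one (by positivity)]
      linarith
    intro q
    induction q with
    | zero =>
      have h0 : 0 ≤ Lx * ‖X 0 - xstar‖ ^ 2 := by positivity
      linarith [hupper (X 0)]
    | succ q ih =>
      have hstep := inexact_gradient_step_le hLx hdiff hsmooth (X q) (g (X q)) (hg (X q))
      rw [← hrec] at hstep
      have hPL := hsc.two_mul_sub_le_norm_gradient_sq hμ hdiff (X q) xstar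
      have hgap : μx * (ℓ (X q) - ℓ xstar) ≤ ‖gradient ℓ (X q)‖ ^ 2 := by
        linarith [mul_nonneg hμ.le (sub_nonneg.2 (hmin (X q)))]
      have hdec : (Δ ^ 2 - ‖gradient ℓ (X q)‖ ^ 2) / (4 * Lx)
          ≤ (Δ ^ 2 - μx * (ℓ (X q) - ℓ xstar)) / (4 * Lx) := by gcongr
      have hrw : (Δ ^ 2 - μx * (ℓ (X q) - ℓ xstar)) / (4 * Lx)
          = Δ ^ 2 / (4 * Lx) - μx / (4 * Lx) * (ℓ (X q) - ℓ xstar) := by ring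
      have hcontr := mul_le_mul_of_nonneg_left ih hρ
      have hfix : Δ ^ 2 / (4 * Lx) ≤ μx / (4 * Lx) * (Δ ^ 2 * (1 / μx + 1 / (2 * Lx))) := by
        have h : μx / (4 * Lx) * (Δ ^ 2 * (1 / μx + 1 / (2 * Lx)))
            = Δ ^ 2 / (4 * Lx) + μx / (4 * Lx) * (Δ ^ 2 * (1 / (2 * Lx))) := by
          field_simp
        rw [h]
        exact le_add_of_nonneg_right (by positivity)
      rw [pow_succ]
      linarith
  · have hzero (y : Euc n) : ‖y - xstar‖ ^ 2 = 0 := by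
      have h := (hlower y).trans (hupper y)
      nlinarith [sq_nonneg ‖y - xstar‖]
    intro q
    have h := hupper (X q)
    rw [hzero] at h
    rw [hzero]
    linarith
end
end
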